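/- arXiv:2010.08035 — 2 statements merged into one kernel-verified Lean document; each statement's English description precedes it below -/
import Mathlib

section
/- Fix an S-structure (𝕊, ℙ) and suppose 𝒟⁺_S satisfies the compact ultrametric property. If v₁ and v₂ are pseudovertices with v₁ ↗ v₂ (a single expansion), then there is a finite sequence v₁ = w₀ ↗ w₁ ↗ ⋯ ↗ wₙ = v₂ in which every expansion w_i ↗ w_{i+1} is a simple expansion. -/
set_option autoImplicit false

namespace GTLD

/-- A partial bijection of `X`: a functional, injective relation on `X`.
It represents a bijection between its domain and its image. -/
structure PartialBij (X : Type*) where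
  rel : X → X → Prop
  functional : ∀ ⦃x y y'⦄, rel x y → rel x y' → y = y'
  injective : ∀ ⦃x x' y⦄, rel x y → rel x' y → x = x'

namespace PartialBij

variable {X : Type*}

/-- The domain of a partial bijection. -/
def domSet (f : PartialBij X) : Set X :=
  {x | ∃ y, f.rel x y}

/-- The image of a partial bijection. -/
def imgSet (f : PartialBij X) : Set X :=
  {y | ∃ x, f.rel x y}

/-- The image of a set under a partial bijection. -/
def image (f : PartialBij X) (A : Set X) : Set X :=
  {y | ∃ x ∈ A, f.rel x y}

/-- Composition `g ∘ f` of partial bijections (first apply `f`, then `g`);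
this is the composition `g ∘ f : f⁻¹(B ∩ C) → g(B ∩ C)` of the paper. -/
def comp (g f : PartialBij X) : PartialBij X where
  rel := fun x z => ∃ y, f.rel x y ∧ g.rel y z
  functional := by
    rintro x z z' ⟨y, h1, h2⟩ ⟨y', h1', h2'⟩
    cases f.functional h1 h1'
    exact g.functional h2 h2'
  injective := by
    rintro x x' z ⟨y, h1, h2⟩ ⟨y', h1', h2'⟩
    cases g.injective h2 h2'
    exact f.injective h1 h1'

/-- The inverse of a partial bijection. -/
def inv (f : PartialBij X) : PartialBij X where
  rel := fun x y => f.rel y x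
  functional := by
    intro x y y' h h'
    exact f.injective h h'
  injective := by
    intro x x' y h h'
    exact f.functional h h'

/-- The restriction of a partial bijection to a subset. -/
def restrict (f : PartialBij X) (A : Set X) : PartialBij X where
  rel := fun x y => x ∈ A ∧ f.rel x y
  functional := by
    rintro x y y' ⟨_, h⟩ ⟨_, h'⟩
    exact f.functional h h'
  injective := by
    rintro x x' y ⟨_, h⟩ ⟨_, h'⟩
    exact f.injective h h'

/-- The identity partial bijection on a subset `A ⊆ X`. -/
def idOn (A : Set X) : PartialBij X where
  rel := fun x y => x ∈ A ∧ x = y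
  functional := by
    rintro x y y' ⟨_, h1⟩ ⟨_, h2⟩
    rw [← h1, ← h2]
  injective := by
    rintro x x' y ⟨_, h1⟩ ⟨_, h2⟩
    rw [h1, h2]

end PartialBij

variable {X : Type*}

/-- `D` is a domain for `S`: it is the domain of some element of `S`. -/
def IsDomain (S : Set (PartialBij X)) (D : Set X) : Prop :=
  ∃ s ∈ S, s.domSet = D

/-- `Y` is a finite disjoint union of domains. -/
def FinDisjUnionOfDomains (S : Set (PartialBij X)) (Y : Set X) : Prop :=
  ∃ (n : ℕ) (D : Fin n → Set X), (∀ i, IsDomain S (D i)) ∧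
    (∀ i j, i ≠ j → D i ∩ D j = ∅) ∧ (⋃ i, D i) = Y

/-- A partial bijection is locally determined by `S`: its domain and image admit
finite partitions into domains such that the restriction of the bijection to each
member of the first partition is an element of `S` mapping it bijectively onto the
corresponding member of the second. -/
def LocallyDetermined (S : Set (PartialBij X)) (f : PartialBij X) : Prop :=
  ∃ (m : ℕ) (t : Fin m → PartialBij X),
    (∀ i, t i ∈ S) ∧
    (∀ i j, i ≠ j → (t i).domSet ∩ (t j).domSet = ∅) ∧
    (∀ i j, i ≠ j → (t i).imgSet ∩ (t j).imgSet = ∅) ∧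
    (⋃ i, (t i).domSet) = f.domSet ∧
    (∀ x y, f.rel x y ↔ ∃ i, (t i).rel x y)

/-- Membership in the group `Γ_S`: a bijection of all of `X` that is
locally determined by `S`. -/
def MemGamma (S : Set (PartialBij X)) (γ : PartialBij X) : Prop :=
  γ.domSet = Set.univ ∧ γ.imgSet = Set.univ ∧ LocallyDetermined S γ

/-- `Pt` is a partition of `D` (into nonempty pieces). -/
def IsPartitionOf (Pt : Set (Set X)) (D : Set X) : Prop :=
  ∅ ∉ Pt ∧ ⋃₀ Pt = D ∧ ∀ P ∈ Pt, ∀ Q ∈ Pt, P ≠ Q → P ∩ Q = ∅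

/-- The set of domains of `S` has the compact ultrametric property:
intersecting domains are nested, and the complement of a domain is a finite
union of domains. -/
def CompactUltrametric (S : Set (PartialBij X)) : Prop :=
  (∀ D₁ D₂, IsDomain S D₁ → IsDomain S D₂ → (D₁ ∩ D₂).Nonempty →
    D₁ ⊆ D₂ ∨ D₂ ⊆ D₁) ∧
  (∀ D, IsDomain S D → ∃ (n : ℕ) (E : Fin n → Set X),
    (∀ i, IsDomain S (E i)) ∧ (⋃ i, E i) = Dᶜ)

/-- `F` is the greatest proper nonempty subdomain of `D` containing `x`. -/
def IsGreatestProperSub (S : Set (PartialBij X)) (D F : Set X) (x : X) : Prop :=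
  IsDomain S F ∧ x ∈ F ∧ F ⊂ D ∧
    ∀ F', IsDomain S F' → x ∈ F' → F' ⊂ D → F' ⊆ F

/-- `maxPart` assigns to each nonempty domain its maximal partition: the partition
into greatest proper nonempty subdomains, or `{D}` if `D` has no proper nonempty
subdomain. -/
def MaxPartSpec (S : Set (PartialBij X)) (maxPart : Set X → Set (Set X)) : Prop :=
  ∀ D, IsDomain S D → D.Nonempty →
    ((∃ F, IsDomain S F ∧ F.Nonempty ∧ F ⊂ D) →
      maxPart D = {F | ∃ x ∈ D, IsGreatestProperSub S D F x}) ∧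
    ((¬ ∃ F, IsDomain S F ∧ F.Nonempty ∧ F ⊂ D) → maxPart D = {D})

/-- An `S`-structure: a structure function `str` assigning structure sets to pairs
of nonempty domains, and a pattern function `pat` assigning sets of patterns
(finite partitions into domains) to nonempty domains, subject to the axioms
(P1)-(P5) and (S1)-(S6). -/
structure SStructure (S : Set (PartialBij X)) where
  str : Set X → Set X → Set (PartialBij X)
  pat : Set X → Set (Set (Set X))
  /-- (P1) the trivial partition is a pattern -/
  pat_trivial : ∀ D, IsDomain S D → D.Nonempty → {D} ∈ pat D
  /-- (P2) each pattern is a finite partition of `D` into domains -/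
  pat_partition : ∀ D, IsDomain S D → D.Nonempty → ∀ Pt ∈ pat D,
    Pt.Finite ∧ IsPartitionOf Pt D ∧ ∀ P ∈ Pt, IsDomain S P
  /-- (P3) restriction -/
  pat_restrict : ∀ D E, IsDomain S D → D.Nonempty → IsDomain S E → E.Nonempty →
    E ⊆ D → ∀ Pt ∈ pat D, {Q | ∃ P ∈ Pt, (P ∩ E).Nonempty ∧ Q = P ∩ E} ∈ pat E
  /-- (P4) patchwork -/
  pat_patchwork : ∀ D, IsDomain S D → D.Nonempty → ∀ Pt ∈ pat D,
    ∀ F : Set X → Set (Set X), (∀ P ∈ Pt, F P ∈ pat P) →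
    {Q | ∃ P ∈ Pt, Q ∈ F P} ∈ pat D
  /-- (P5) cofinality -/
  pat_cofinal : ∀ D, IsDomain S D → D.Nonempty →
    ∀ Pt' : Set (Set X), Pt'.Finite → IsPartitionOf Pt' D →
    (∀ P ∈ Pt', IsDomain S P) →
    ∃ Pt ∈ pat D, ∀ P ∈ Pt, ∃ P' ∈ Pt', P ⊆ P'
  /-- (S1) elements of `str D₁ D₂` lie in `S`, with domain `D₁` and image `D₂` -/
  str_mem : ∀ D₁ D₂, ∀ s ∈ str D₁ D₂, s ∈ S ∧ s.domSet = D₁ ∧ s.imgSet = D₂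
  /-- (S2) identities -/
  str_id : ∀ D, IsDomain S D → D.Nonempty → PartialBij.idOn D ∈ str D D
  /-- (S3) inverses -/
  str_inv : ∀ D₁ D₂, ∀ s ∈ str D₁ D₂, PartialBij.inv s ∈ str D₂ D₁
  /-- (S4) compositions -/
  str_comp : ∀ D₁ D₂ D₃, ∀ s₁ ∈ str D₁ D₂, ∀ s₂ ∈ str D₂ D₃,
    PartialBij.comp s₂ s₁ ∈ str D₁ D₃
  /-- (S5) generation -/
  generation : ∀ f : PartialBij X, IsDomain S f.domSet → f.domSet.Nonempty →
    LocallyDetermined S f →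
    ∃ Pt ∈ pat f.domSet, ∀ E ∈ Pt,
      f.restrict E ∈ S ∧ f.restrict E ∈ str E (f.image E)
  /-- (S6) `𝕊`-invariance of `ℙ` -/
  pat_invariant : ∀ D₁ D₂, IsDomain S D₁ → D₁.Nonempty → ∀ Pt ∈ pat D₁,
    ∀ s ∈ str D₁ D₂, {Q | ∃ P ∈ Pt, Q = PartialBij.image s P} ∈ pat D₂

/-- The maximal `S`-structure: the structure sets are all elements of `S` with the
given domain and image, and the patterns are all finite partitions into domains. -/
def IsMaximalSStructure {S : Set (PartialBij X)} (SS : SStructure S) : Prop :=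
  (∀ D₁ D₂, IsDomain S D₁ → D₁.Nonempty → IsDomain S D₂ → D₂.Nonempty →
    SS.str D₁ D₂ = {s | s ∈ S ∧ s.domSet = D₁ ∧ s.imgSet = D₂}) ∧
  (∀ D, IsDomain S D → D.Nonempty →
    SS.pat D = {Pt | Pt.Finite ∧ IsPartitionOf Pt D ∧ ∀ P ∈ Pt, IsDomain S P})

/-- `f` is (a representative of) an element `[f, D]` of `ℬ`: its domain is a
nonempty domain and it is locally determined by `S`. -/
def IsSPair (S : Set (PartialBij X)) (f : PartialBij X) : Prop :=
  IsDomain S f.domSet ∧ f.domSet.Nonempty ∧ LocallyDetermined S f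

/-- The fundamental equivalence relation on pairs: `(f, D₁) ∼ (g, D₂)` iff
`f = g ∘ h` for some `h ∈ 𝕊(D₁, D₂)`. -/
def PairRel {S : Set (PartialBij X)} (SS : SStructure S) (f g : PartialBij X) : Prop :=
  ∃ h ∈ SS.str f.domSet g.domSet, f = PartialBij.comp g h

/-- A pseudovertex: a nonempty finite set of (representatives of) elements of `ℬ`
whose images are pairwise disjoint. -/
def IsPseudovertex (S : Set (PartialBij X)) (v : Set (PartialBij X)) : Prop :=
  v.Finite ∧ v.Nonempty ∧ (∀ f ∈ v, IsSPair S f) ∧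
    ∀ f ∈ v, ∀ g ∈ v, f ≠ g → f.imgSet ∩ g.imgSet = ∅

/-- The image of a pseudovertex. -/
def PVImage (v : Set (PartialBij X)) : Set X :=
  ⋃ f ∈ v, f.imgSet

/-- Two (representative sets of) pseudovertices are equal as sets of equivalence
classes. -/
def PVEquiv {S : Set (PartialBij X)} (SS : SStructure S)
    (v w : Set (PartialBij X)) : Prop :=
  (∀ f ∈ v, ∃ g ∈ w, PairRel SS f g) ∧ (∀ g ∈ w, ∃ f ∈ v, PairRel SS f g)

/-- An expansion of a pseudovertex `v` at an element `f ∈ v`: replace `f` by the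
pieces `(f ∘ h)|_E` for `E` in a nontrivial pattern `Pt` of a domain `D̂`, where
`h ∈ 𝕊(D̂, dom f)`. -/
def Expansion {S : Set (PartialBij X)} (SS : SStructure S)
    (v v' : Set (PartialBij X)) : Prop :=
  ∃ f ∈ v, ∃ (Dh : Set X) (h : PartialBij X) (Pt : Set (Set X)),
    h ∈ SS.str Dh f.domSet ∧ Pt ∈ SS.pat Dh ∧
    (∃ P ∈ Pt, ∃ Q ∈ Pt, P ≠ Q) ∧
    v' = (v \ {f}) ∪ {g | ∃ E ∈ Pt, g = (PartialBij.comp f h).restrict E}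

/-- The partial order on pseudovertices induced by expansion (at the level of
sets of equivalence classes): `v ≤ w` iff a finite (possibly empty) sequence of
expansions leads from `v` to a pseudovertex equal to `w` as a set of classes. -/
def PVLE {S : Set (PartialBij X)} (SS : SStructure S)
    (v w : Set (PartialBij X)) : Prop :=
  ∃ w', Relation.ReflTransGen (Expansion SS) v w' ∧ PVEquiv SS w' w

/-- Strict version of `PVLE`. -/
def PVLT {S : Set (PartialBij X)} (SS : SStructure S)
    (v w : Set (PartialBij X)) : Prop :=
  PVLE SS v w ∧ ¬ PVEquiv SS v w

/-- The action of a partial bijection `s` on a pseudovertex: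
`s · {[f₁,D₁],…,[fₘ,Dₘ]} = {[s∘f₁,D₁],…,[s∘fₘ,Dₘ]}`. -/
def PVAct (s : PartialBij X) (v : Set (PartialBij X)) : Set (PartialBij X) :=
  (fun f => PartialBij.comp s f) '' v

/-- Two pseudovertices have the same type: there is a bijection between them
matching domains of the same domain type. -/
def SameType {S : Set (PartialBij X)} (SS : SStructure S)
    (v w : Set (PartialBij X)) : Prop :=
  ∃ φ : PartialBij X → PartialBij X, Set.BijOn φ v w ∧
    ∀ f ∈ v, (SS.str f.domSet (φ f).domSet).Nonempty

/-- The stabilizer of a pseudovertex `v` in `Γ_S`. -/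
def PVStab {S : Set (PartialBij X)} (SS : SStructure S)
    (v : Set (PartialBij X)) : Set (PartialBij X) :=
  {γ | MemGamma S γ ∧ PVEquiv SS (PVAct γ v) v}

/-- The subgroup of the stabilizer fixing each class `[f, D] ∈ v`. -/
def PVStabFix {S : Set (PartialBij X)} (SS : SStructure S)
    (v : Set (PartialBij X)) : Set (PartialBij X) :=
  {γ | MemGamma S γ ∧ ∀ f ∈ v, PairRel SS (PartialBij.comp γ f) f}

/-- `Pt₁ ⪯ Pt₂`: the partition `Pt₂` is obtained from `Pt₁` by replacing each
member `D` of `Pt₁` by a pattern of `D`. -/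
def PatRefines {S : Set (PartialBij X)} (SS : SStructure S)
    (Pt₁ Pt₂ : Set (Set X)) : Prop :=
  ∃ F : Set X → Set (Set X), (∀ D ∈ Pt₁, F D ∈ SS.pat D) ∧
    Pt₂ = {Q | ∃ D ∈ Pt₁, Q ∈ F D}

/-- A simple expansion: an expansion using the maximal partition. -/
def SimpleExpansion {S : Set (PartialBij X)} (SS : SStructure S)
    (maxPart : Set X → Set (Set X)) (v v' : Set (PartialBij X)) : Prop :=
  ∃ f ∈ v, ∃ (Dh : Set X) (h : PartialBij X),
    h ∈ SS.str Dh f.domSet ∧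
    (∃ P ∈ maxPart Dh, ∃ Q ∈ maxPart Dh, P ≠ Q) ∧
    v' = (v \ {f}) ∪ {g | ∃ E ∈ maxPart Dh, g = (PartialBij.comp f h).restrict E}

/-- `v'` is the result of `ℰ`-expansion from `v`. -/
def EExpansionFrom (E : PartialBij X → Set (Set (PartialBij X)))
    (v v' : Set (PartialBij X)) : Prop :=
  ∃ F : PartialBij X → Set (PartialBij X),
    (∀ f ∈ v, F f ∈ E f) ∧ v' = ⋃ f ∈ v, F f

/-- `E` is an expansion scheme: conditions (1)-(4) of Definition 6.1. -/
def IsExpansionScheme {S : Set (PartialBij X)} (SS : SStructure S)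
    (E : PartialBij X → Set (Set (PartialBij X))) : Prop :=
  ∀ f : PartialBij X, IsSPair S f →
    (∀ w ∈ E f, IsPseudovertex S w ∧ PVLE SS {f} w) ∧
    ({f} ∈ E f) ∧
    (∀ s : PartialBij X, LocallyDetermined S s → f.imgSet ⊆ s.domSet →
      (∀ w ∈ E f, ∃ w' ∈ E (PartialBij.comp s f), PVEquiv SS (PVAct s w) w') ∧
      (∀ w' ∈ E (PartialBij.comp s f), ∃ w ∈ E f, PVEquiv SS (PVAct s w) w')) ∧
    (∀ w₁ ∈ E f, ∀ w₂ ∈ E f, PVLE SS w₁ w₂ → EExpansionFrom E w₁ w₂)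

/-- An `ℰ`-chain: a strictly increasing sequence of pseudovertices, each of which
is the result of `ℰ`-expansion from the first. -/
def IsEChain {S : Set (PartialBij X)} (SS : SStructure S)
    (E : PartialBij X → Set (Set (PartialBij X)))
    (m : ℕ) (c : Fin (m + 1) → Set (PartialBij X)) : Prop :=
  (∀ i, IsPseudovertex S (c i)) ∧
  (∀ i j : Fin (m + 1), i < j → PVLT SS (c i) (c j)) ∧
  (∀ i, EExpansionFrom E (c 0) (c i))

end GTLD

namespace GTLD

/-- `A` is a family of disjoint nonempty domains which is coarser than `Pt`. -/
structure Coarse {X : Type*} (S : Set (PartialBij X)) (Pt A : Set (Set X)) : Prop where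
  dom : ∀ E ∈ A, IsDomain S E
  ne : ∀ E ∈ A, E.Nonempty
  disj : ∀ E ∈ A, ∀ F ∈ A, (E ∩ F).Nonempty → E = F
  cov : ∀ P ∈ Pt, ∃ E ∈ A, P ⊆ E
  un : ∀ E ∈ A, ∀ x ∈ E, ∃ P ∈ Pt, x ∈ P ∧ P ⊆ E

theorem exists_greatest {X : Type*} (S : Set (PartialBij X)) (hcu : CompactUltrametric S)
    (Pt : Set (Set X)) (hfin : Pt.Finite) (hdom : ∀ P ∈ Pt, IsDomain S P)
    (hdisj : ∀ P ∈ Pt, ∀ Q ∈ Pt, (P ∩ Q).Nonempty → P = Q)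
    (D : Set X) (hDP : D ∉ Pt)
    (hun : ∀ x ∈ D, ∃ P ∈ Pt, x ∈ P ∧ P ⊆ D) (x : X) (hx : x ∈ D) :
    ∃ F, IsGreatestProperSub S D F x := by
  obtain ⟨P, hP, hxP, hPD⟩ := hun x hx
  have hPD' : P ⊂ D := hPD.ssubset_of_ne (fun h => hDP (h ▸ hP))
  let T : Set (Set X) := {E | IsDomain S E ∧ P ⊆ E ∧ E ⊂ D}
  have hTun : ∀ E ∈ T, ∀ y ∈ E, ∃ Q ∈ Pt, y ∈ Q ∧ Q ⊆ E := by
    rintro E ⟨hE, hPE, hED⟩ y hy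
    obtain ⟨Q, hQ, hyQ, -⟩ := hun y (hED.1 hy)
    refine ⟨Q, hQ, hyQ, ?_⟩
    rcases hcu.1 E Q hE (hdom Q hQ) ⟨y, hy, hyQ⟩ with h | h
    · have : P = Q := hdisj P hP Q hQ ⟨x, hxP, h (hPE hxP)⟩
      exact this ▸ hPE
    · exact h
  have hTfin : T.Finite := by
    apply Set.Finite.subset (hfin.finite_subsets.image (fun U : Set (Set X) => Set.sUnion U))
    intro E hE
    refine ⟨{Q | Q ∈ Pt ∧ Q ⊆ E}, fun Q hQ => hQ.1, ?_⟩
    ext y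
    constructor
    · rintro ⟨Q, ⟨_, h⟩, hy⟩
      exact h hy
    · intro hy
      obtain ⟨Q, hQ, hyQ, hQE⟩ := hTun E hE y hy
      exact ⟨Q, ⟨hQ, hQE⟩, hyQ⟩
  obtain ⟨M, hM⟩ := hTfin.exists_maximal ⟨P, hdom P hP, subset_rfl, hPD'⟩
  refine ⟨M, hM.prop.1, hM.prop.2.1 hxP, hM.prop.2.2, ?_⟩
  intro F hF hxF hFD
  rcases hcu.1 F M hF hM.prop.1 ⟨x, hxF, hM.prop.2.1 hxP⟩ with h | h
  · exact h
  · exact hM.le_of_ge ⟨hF, hM.prop.2.1.trans h, hFD⟩ h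

theorem refine_step {X : Type*} (S : Set (PartialBij X)) (hcu : CompactUltrametric S)
    (maxPart : Set X → Set (Set X)) (hmax : MaxPartSpec S maxPart)
    (Pt : Set (Set X)) (hfin : Pt.Finite) (hdom : ∀ P ∈ Pt, IsDomain S P)
    (hne : ∀ P ∈ Pt, P.Nonempty)
    (hdisj : ∀ P ∈ Pt, ∀ Q ∈ Pt, (P ∩ Q).Nonempty → P = Q)
    (A : Set (Set X)) (hA : Coarse S Pt A) (D : Set X) (hD : D ∈ A) (hDP : D ∉ Pt) :
    (∃ P ∈ maxPart D, ∃ Q ∈ maxPart D, P ≠ Q) ∧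
    (∀ E ∈ maxPart D, E ⊆ D) ∧
    Coarse S Pt ((A \ {D}) ∪ maxPart D) ∧
    {p : Set X × Set X | p ∈ Pt ×ˢ Pt ∧ ∃ E ∈ (A \ {D}) ∪ maxPart D, p.1 ⊆ E ∧ p.2 ⊆ E} ⊂
      {p : Set X × Set X | p ∈ Pt ×ˢ Pt ∧ ∃ E ∈ A, p.1 ⊆ E ∧ p.2 ⊆ E} := by
  have hgr := exists_greatest S hcu Pt hfin hdom hdisj D hDP (hA.un D hD)
  obtain ⟨x, hx⟩ := hA.ne D hD
  have hmp : maxPart D = {F | ∃ x ∈ D, IsGreatestProperSub S D F x} := by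
    apply (hmax D (hA.dom D hD) ⟨x, hx⟩).1
    obtain ⟨F, hF⟩ := hgr x hx
    exact ⟨F, hF.1, ⟨x, hF.2.1⟩, hF.2.2.1⟩
  have hsub : ∀ E ∈ maxPart D, E ⊂ D := by
    rw [hmp]
    rintro E ⟨y, _, h⟩
    exact h.2.2.1
  have hex : ∀ y ∈ D, ∃ F ∈ maxPart D, y ∈ F := by
    intro y hy
    obtain ⟨F, hF⟩ := hgr y hy
    exact ⟨F, by rw [hmp]; exact ⟨y, hy, hF⟩, hF.2.1⟩
  have hmdom : ∀ E ∈ maxPart D, IsDomain S E := by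
    rw [hmp]
    rintro E ⟨y, _, h⟩
    exact h.1
  have hmne : ∀ E ∈ maxPart D, E.Nonempty := by
    rw [hmp]
    rintro E ⟨y, _, h⟩
    exact ⟨y, h.2.1⟩
  have hmle : ∀ E ∈ maxPart D, ∀ F, IsDomain S F → F ⊂ D → (E ∩ F).Nonempty → F ⊆ E := by
    rw [hmp]
    rintro E ⟨y, _, h⟩ F hF hFD hEF
    rcases hcu.1 E F h.1 hF hEF with h' | h'
    · exact h.2.2.2 F hF (h' h.2.1) hFD
    · exact h'
  have hmdisj : ∀ E ∈ maxPart D, ∀ F ∈ maxPart D, (E ∩ F).Nonempty → E = F := by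
    intro E hE F hF hEF
    apply Set.Subset.antisymm
    · exact hmle F hF E (hmdom E hE) (hsub E hE) (by rwa [Set.inter_comm])
    · exact hmle E hE F (hmdom F hF) (hsub F hF) hEF
  have hPlt : ∀ P ∈ Pt, P ⊆ D → P ⊂ D := fun P hP h =>
    h.ssubset_of_ne (fun e => hDP (e ▸ hP))
  have hmun : ∀ E ∈ maxPart D, ∀ y ∈ E, ∃ P ∈ Pt, y ∈ P ∧ P ⊆ E := by
    intro E hE y hy
    obtain ⟨P, hP, hyP, hPD⟩ := hA.un D hD y ((hsub E hE).1 hy)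
    exact ⟨P, hP, hyP, hmle E hE P (hdom P hP) (hPlt P hP hPD) ⟨y, hy, hyP⟩⟩
  obtain ⟨F, hF, hxF⟩ := hex x hx
  obtain ⟨y, hyD, hyF⟩ := Set.exists_of_ssubset (hsub F hF)
  obtain ⟨G, hG, hyG⟩ := hex y hyD
  refine ⟨⟨F, hF, G, hG, fun h => hyF (h ▸ hyG)⟩, fun E hE => (hsub E hE).1, ?_, ?_⟩
  · have hcross : ∀ E ∈ A \ {D}, ∀ F ∈ maxPart D, ¬ (E ∩ F).Nonempty := by
      rintro E ⟨hE, hED⟩ F hF ⟨z, hzE, hzF⟩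
      exact hED (hA.disj E hE D hD ⟨z, hzE, (hsub F hF).1 hzF⟩)
    refine ⟨?_, ?_, ?_, ?_, ?_⟩
    · rintro E (hE | hE)
      · exact hA.dom E hE.1
      · exact hmdom E hE
    · rintro E (hE | hE)
      · exact hA.ne E hE.1
      · exact hmne E hE
    · rintro E (hE | hE) F (hF | hF) h
      · exact hA.disj E hE.1 F hF.1 h
      · exact (hcross E hE F hF h).elim
      · exact (hcross F hF E hE (by rwa [Set.inter_comm])).elim
      · exact hmdisj E hE F hF h
    · intro P hP
      obtain ⟨E, hE, hPE⟩ := hA.cov P hP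
      by_cases hED : E = D
      · subst hED
        obtain ⟨z, hz⟩ := hne P hP
        obtain ⟨F, hF, hzF⟩ := hex z (hPE hz)
        exact ⟨F, Or.inr hF, hmle F hF P (hdom P hP) (hPlt P hP hPE) ⟨z, hzF, hz⟩⟩
      · exact ⟨E, Or.inl ⟨hE, hED⟩, hPE⟩
    · rintro E (hE | hE)
      · exact hA.un E hE.1
      · exact hmun E hE
  · refine ⟨?_, ?_⟩
    · rintro p ⟨hp, E, hE | hE, h⟩
      · exact ⟨hp, E, hE.1, h⟩
      · exact ⟨hp, D, hD, h.1.trans (hsub E hE).1, h.2.trans (hsub E hE).1⟩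
    · intro hcon
      obtain ⟨P, hP, hxP, hPF⟩ := hmun F hF x hxF
      obtain ⟨Q, hQ, hyQ, hQG⟩ := hmun G hG y hyG
      obtain ⟨-, E, hE | hE, h1, h2⟩ := hcon (a := (P, Q))
        ⟨⟨hP, hQ⟩, D, hD, hPF.trans (hsub F hF).1, hQG.trans (hsub G hG).1⟩
      · exact hE.2 (hA.disj E hE.1 D hD ⟨x, h1 hxP, hx⟩)
      · have : E = F := hmdisj E hE F hF ⟨x, h1 hxP, hxF⟩
        exact hyF (this ▸ h2 hyQ)

theorem PartialBij.ext_rel {X : Type*} {f g : PartialBij X}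
    (h : ∀ x y, f.rel x y ↔ g.rel x y) : f = g := by
  cases f; cases g
  congr
  funext x y
  exact propext (h x y)

theorem restrict_dom {X : Type*} (k : PartialBij X) (D : Set X) (h : D ⊆ k.domSet) :
    (k.restrict D).domSet = D := by
  ext x
  constructor
  · rintro ⟨y, hy, _⟩
    exact hy
  · intro hx
    obtain ⟨y, hy⟩ := h hx
    exact ⟨y, hx, hy⟩

theorem restrict_sub {X : Type*} (k : PartialBij X) (D E : Set X) (h : E ⊆ D) :
    (PartialBij.comp (k.restrict D) (PartialBij.idOn D)).restrict E = k.restrict E := by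
  apply PartialBij.ext_rel
  intro x y
  constructor
  · rintro ⟨hx, z, ⟨_, rfl⟩, _, h2⟩
    exact ⟨hx, h2⟩
  · rintro ⟨hx, h2⟩
    exact ⟨hx, x, ⟨h hx, rfl⟩, h hx, h2⟩

/-- The family of restrictions of `k` to members of `A`, together with `u`. -/
def fam {X : Type*} (u : Set (PartialBij X)) (k : PartialBij X) (A : Set (Set X)) :
    Set (PartialBij X) :=
  u ∪ {g | ∃ E ∈ A, g = k.restrict E}

theorem simple_step {X : Type*} (S : Set (PartialBij X)) (SS : SStructure S)
    (maxPart : Set X → Set (Set X)) (u : Set (PartialBij X)) (k : PartialBij X)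
    (hu : ∀ D : Set X, D.Nonempty → D ⊆ k.domSet → k.restrict D ∉ u)
    (A : Set (Set X)) (hAk : ∀ E ∈ A, E ⊆ k.domSet) (D : Set X) (hD : D ∈ A)
    (hDd : IsDomain S D) (hDn : D.Nonempty)
    (h2 : ∃ P ∈ maxPart D, ∃ Q ∈ maxPart D, P ≠ Q) (hsub : ∀ E ∈ maxPart D, E ⊆ D) :
    SimpleExpansion SS maxPart (fam u k A) (fam u k ((A \ {D}) ∪ maxPart D)) := by
  have hdd := restrict_dom k D (hAk D hD)
  refine ⟨k.restrict D, Or.inr ⟨D, hD, rfl⟩, D, PartialBij.idOn D, ?_, h2, ?_⟩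
  · rw [hdd]
    exact SS.str_id D hDd hDn
  · ext g
    constructor
    · rintro (hg | ⟨E, ⟨hE, hED⟩ | hE, rfl⟩)
      · refine Or.inl ⟨Or.inl hg, ?_⟩
        rintro rfl
        exact hu D hDn (hAk D hD) hg
      · refine Or.inl ⟨Or.inr ⟨E, hE, rfl⟩, ?_⟩
        intro h
        apply hED
        have h' : k.restrict E = k.restrict D := h
        have := congrArg PartialBij.domSet h'
        rwa [hdd, restrict_dom k E (hAk E hE)] at this
      · exact Or.inr ⟨E, hE, (restrict_sub k D E (hsub E hE)).symm⟩
    · rintro (⟨hg | ⟨E, hE, rfl⟩, hgD⟩ | ⟨E, hE, rfl⟩)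
      · exact Or.inl hg
      · refine Or.inr ⟨E, Or.inl ⟨hE, ?_⟩, rfl⟩
        intro h
        apply hgD
        have h' : E = D := h
        rw [h']
        rfl
      · exact Or.inr ⟨E, Or.inr hE, restrict_sub k D E (hsub E hE)⟩

theorem reach {X : Type*} (S : Set (PartialBij X)) (SS : SStructure S)
    (hcu : CompactUltrametric S)
    (maxPart : Set X → Set (Set X)) (hmax : MaxPartSpec S maxPart)
    (Pt : Set (Set X)) (hfin : Pt.Finite) (hdom : ∀ P ∈ Pt, IsDomain S P)
    (hne : ∀ P ∈ Pt, P.Nonempty)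
    (hdisj : ∀ P ∈ Pt, ∀ Q ∈ Pt, (P ∩ Q).Nonempty → P = Q)
    (u : Set (PartialBij X)) (k : PartialBij X) (hPk : ∀ P ∈ Pt, P ⊆ k.domSet)
    (hu : ∀ D : Set X, D.Nonempty → D ⊆ k.domSet → k.restrict D ∉ u) :
    ∀ (N : ℕ) (A : Set (Set X)), Coarse S Pt A →
    {p : Set X × Set X | p ∈ Pt ×ˢ Pt ∧ ∃ E ∈ A, p.1 ⊆ E ∧ p.2 ⊆ E}.ncard = N →
    Relation.ReflTransGen (SimpleExpansion SS maxPart) (fam u k A) (fam u k Pt) := by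
  intro N
  induction N using Nat.strong_induction_on with
  | _ N ih =>
    intro A hA hN
    by_cases hsub : A ⊆ Pt
    · have : A = Pt := by
        apply Set.Subset.antisymm hsub
        intro P hP
        obtain ⟨E, hE, hPE⟩ := hA.cov P hP
        obtain ⟨z, hz⟩ := hne P hP
        have : P = E := hdisj P hP E (hsub hE) ⟨z, hz, hPE hz⟩
        exact this ▸ hE
      rw [this]
    · obtain ⟨D, hD, hDP⟩ := Set.not_subset.1 hsub
      obtain ⟨h2, hs, hC, hlt⟩ := refine_step S hcu maxPart hmax Pt hfin hdom hne hdisj A hA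
        D hD hDP
      have hAk : ∀ E ∈ A, E ⊆ k.domSet := by
        intro E hE z hz
        obtain ⟨P, hP, hzP, -⟩ := hA.un E hE z hz
        exact hPk P hP hzP
      have hcard := Set.ncard_lt_ncard hlt ((hfin.prod hfin).subset (fun p hp => hp.1))
      exact Relation.ReflTransGen.head
        (simple_step S SS maxPart u k hu A hAk D hD (hA.dom D hD) (hA.ne D hD) h2 hs)
        (ih _ (hN ▸ hcard) _ hC rfl)

theorem seq_of_reach {α : Type*} (r : α → α → Prop) (a b : α)
    (h : Relation.ReflTransGen r a b) :
    ∃ (n : ℕ) (w : ℕ → α), w 0 = a ∧ w n = b ∧ ∀ i < n, r (w i) (w (i + 1)) := by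
  induction h using Relation.ReflTransGen.head_induction_on with
  | refl => exact ⟨0, fun _ => b, rfl, rfl, fun i hi => absurd hi (Nat.not_lt_zero i)⟩
  | @head a c hac _ ih =>
    obtain ⟨n, w, h0, hn, hw⟩ := ih
    refine ⟨n + 1, fun i => Nat.casesOn i a w, rfl, hn, ?_⟩
    intro i hi
    cases i with
    | zero => simpa [h0] using hac
    | succ j => exact hw j (by omega)

/-- if the set of nonempty domains satisfies the compact ultrametric
property, then every expansion factors as a finite sequence of simple
expansions. -/
theorem statement18 {X : Type*} (S : Set (PartialBij X))
    (hcomp : ∀ f ∈ S, ∀ g ∈ S, PartialBij.comp g f ∈ S)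
    (hinv : ∀ f ∈ S, PartialBij.inv f ∈ S)
    (SS : SStructure S)
    (hcu : CompactUltrametric S)
    (maxPart : Set X → Set (Set X)) (hmax : MaxPartSpec S maxPart)
    (v₁ v₂ : Set (PartialBij X)) (h₁ : IsPseudovertex S v₁)
    (hexp : Expansion SS v₁ v₂) :
    ∃ (n : ℕ) (w : ℕ → Set (PartialBij X)), w 0 = v₁ ∧ w n = v₂ ∧
      ∀ i < n, SimpleExpansion SS maxPart (w i) (w (i + 1)) := by
  obtain ⟨f, hf, Dh, h, Pt, hh, hPt, ⟨P₀, hP₀, Q₀, hQ₀, hPQ⟩, rfl⟩ := hexp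
  obtain ⟨hhS, hhd, hhi⟩ := SS.str_mem _ _ h hh
  obtain ⟨hfd, ⟨a, ha⟩, -⟩ := h₁.2.2.1 f hf
  have hDh : IsDomain S Dh := ⟨h, hhS, hhd⟩
  have hkd : (PartialBij.comp f h).domSet = Dh := by
    rw [← hhd]
    ext x
    constructor
    · rintro ⟨z, y, hy, _⟩
      exact ⟨y, hy⟩
    · rintro ⟨y, hy⟩
      have : y ∈ f.domSet := by
        rw [← hhi]
        exact ⟨x, hy⟩
      obtain ⟨z, hz⟩ := this
      exact ⟨z, y, hy, hz⟩
  have hDn : Dh.Nonempty := by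
    rw [← hhi] at ha
    obtain ⟨x, hx⟩ := ha
    rw [← hhd]
    exact ⟨x, a, hx⟩
  obtain ⟨hfin, ⟨hemp, hU, hdj⟩, hdom⟩ := SS.pat_partition Dh hDh hDn Pt hPt
  have hne : ∀ P ∈ Pt, P.Nonempty := by
    intro P hP
    rw [Set.nonempty_iff_ne_empty]
    rintro rfl
    exact hemp hP
  have hdisj : ∀ P ∈ Pt, ∀ Q ∈ Pt, (P ∩ Q).Nonempty → P = Q := by
    intro P hP Q hQ hn
    by_contra hc
    rw [hdj P hP Q hQ hc] at hn
    exact Set.not_nonempty_empty hn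
  have hPD : ∀ P ∈ Pt, P ⊆ Dh := by
    intro P hP
    rw [← hU]
    exact Set.subset_sUnion_of_mem hP
  have hDP : Dh ∉ Pt := by
    intro hc
    have key : ∀ P ∈ Pt, P = Dh := by
      intro P hP
      obtain ⟨z, hz⟩ := hne P hP
      exact hdisj P hP Dh hc ⟨z, hz, hPD P hP hz⟩
    exact hPQ ((key P₀ hP₀).trans (key Q₀ hQ₀).symm)
  have hC : Coarse S Pt {Dh} := by
    refine ⟨?_, ?_, ?_, ?_, ?_⟩
    · rintro E rfl
      exact hDh
    · rintro E rfl
      exact hDn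
    · rintro E rfl F rfl _
      rfl
    · intro P hP
      exact ⟨Dh, rfl, hPD P hP⟩
    · rintro E rfl x hx
      rw [← hU] at hx
      obtain ⟨P, hP, hxP⟩ := hx
      exact ⟨P, hP, hxP, hPD P hP⟩
  obtain ⟨h2, hs, hC', -⟩ := refine_step S hcu maxPart hmax Pt hfin hdom hne hdisj {Dh} hC
    Dh rfl hDP
  rw [Set.sdiff_self, Set.empty_union] at hC'
  have hu : ∀ D : Set X, D.Nonempty → D ⊆ (PartialBij.comp f h).domSet →
      (PartialBij.comp f h).restrict D ∉ v₁ \ {f} := by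
    rintro D ⟨x, hx⟩ hDk ⟨hm, hmf⟩
    obtain ⟨z, y, hy, hz⟩ := hDk hx
    have he := h₁.2.2.2 _ hm f hf hmf
    have : z ∈ ((PartialBij.comp f h).restrict D).imgSet ∩ f.imgSet :=
      ⟨⟨x, hx, y, hy, hz⟩, ⟨y, hz⟩⟩
    rw [he] at this
    exact this
  have hr := reach S SS hcu maxPart hmax Pt hfin hdom hne hdisj (v₁ \ {f})
    (PartialBij.comp f h) (fun P hP => by rw [hkd]; exact hPD P hP) hu _ (maxPart Dh) hC' rfl
  exact seq_of_reach _ _ _ (Relation.ReflTransGen.head ⟨f, hf, Dh, h, hh, h2, rfl⟩ hr)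

end GTLD
end

section
/- Fix an S-structure (𝕊, ℙ) and let ℰ be an expansion scheme. If v₁ < v₂ < ⋯ < vₘ is an ℰ-chain with m ≥ 2, then for every i ∈ {1,…,m} the sequence obtained by omitting v_i, namely v₁ < ⋯ < v̂_i < ⋯ < vₘ, is again an ℰ-chain. -/
set_option autoImplicit false

namespace GTLD

theorem pairRel_img {X : Type*} {S : Set (PartialBij X)} (SS : SStructure S)
    {f g : PartialBij X} (h : PairRel SS f g) : f.imgSet = g.imgSet := by
  obtain ⟨k, hk, e⟩ := h
  have hi := (SS.str_mem _ _ _ hk).2.2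
  rw [e]
  ext y
  constructor
  · rintro ⟨x, z, _, h2⟩
    exact ⟨z, h2⟩
  · rintro ⟨z, hz⟩
    have hz' : z ∈ k.imgSet := by
      rw [hi]
      exact ⟨y, hz⟩
    obtain ⟨x, hx⟩ := hz'
    exact ⟨x, z, hx, hz⟩

theorem piece_img {X : Type*} {S : Set (PartialBij X)} (SS : SStructure S)
    {f h : PartialBij X} {Dh : Set X} {Pt : Set (Set X)}
    (hf : f.imgSet.Nonempty)
    (hh : h ∈ SS.str Dh f.domSet) (hP : Pt ∈ SS.pat Dh) {P : Set X} (hPP : P ∈ Pt) :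
    ((PartialBij.comp f h).restrict P).imgSet.Nonempty ∧
      ((PartialBij.comp f h).restrict P).imgSet ⊆ f.imgSet := by
  obtain ⟨hS, hd, hi⟩ := SS.str_mem _ _ _ hh
  constructor
  · have hne : Dh.Nonempty := by
      obtain ⟨y, x, hxy⟩ := hf
      have hx : x ∈ h.imgSet := by
        rw [hi]
        exact ⟨y, hxy⟩
      obtain ⟨z, hz⟩ := hx
      exact ⟨z, hd ▸ ⟨x, hz⟩⟩
    obtain ⟨_, ⟨h0, hU, _⟩, _⟩ := SS.pat_partition Dh ⟨h, hS, hd⟩ hne Pt hP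
    have hPne : P.Nonempty := by
      rw [Set.nonempty_iff_ne_empty]
      rintro rfl
      exact h0 hPP
    obtain ⟨x, hx⟩ := hPne
    have hxD : x ∈ h.domSet := by
      rw [hd, ← hU]
      exact ⟨P, hPP, hx⟩
    obtain ⟨y, hy⟩ := hxD
    have hyi : y ∈ f.domSet := by
      rw [← hi]
      exact ⟨x, hy⟩
    obtain ⟨z, hz⟩ := hyi
    exact ⟨z, x, hx, y, hy, hz⟩
  · rintro z ⟨x, _, y, _, hz⟩
    exact ⟨y, hz⟩

/-- Image nonempty and either inside `A` or disjoint from `A`. -/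
def Adapted {X : Type*} (A : Set X) (v : Set (PartialBij X)) : Prop :=
  ∀ g ∈ v, g.imgSet.Nonempty ∧ (g.imgSet ⊆ A ∨ g.imgSet ∩ A = ∅)

/-- Members of `v` with image in `A`. -/
def Part {X : Type*} (A : Set X) (v : Set (PartialBij X)) : Set (PartialBij X) :=
  {g | g ∈ v ∧ g.imgSet ⊆ A}

theorem step {X : Type*} {S : Set (PartialBij X)} (SS : SStructure S) (A : Set X)
    {v w : Set (PartialBij X)} (hv : Adapted A v) (h : Expansion SS v w) :
    Adapted A w ∧ Relation.ReflTransGen (Expansion SS) (Part A v) (Part A w) := by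
  obtain ⟨f, hf, Dh, k, Pt, hk, hPt, hne, rfl⟩ := h
  have hp := fun {P} (hP : P ∈ Pt) => piece_img SS (hv f hf).1 hk hPt hP
  constructor
  · rintro g (⟨hg, _⟩ | ⟨P, hP, rfl⟩)
    · exact hv g hg
    · refine ⟨(hp hP).1, ?_⟩
      rcases (hv f hf).2 with h1 | h1
      · exact Or.inl ((hp hP).2.trans h1)
      · right
        exact Set.subset_eq_empty (Set.inter_subset_inter_left A (hp hP).2) h1
  · rcases (hv f hf).2 with h1 | h1
    · apply Relation.ReflTransGen.single
      refine ⟨f, ⟨hf, h1⟩, Dh, k, Pt, hk, hPt, hne, ?_⟩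
      ext g
      constructor
      · rintro ⟨⟨hg, hgf⟩ | hg, hA⟩
        · exact Or.inl ⟨⟨hg, hA⟩, hgf⟩
        · exact Or.inr hg
      · rintro (⟨⟨hg, hA⟩, hgf⟩ | ⟨P, hP, rfl⟩)
        · exact ⟨Or.inl ⟨hg, hgf⟩, hA⟩
        · exact ⟨Or.inr ⟨P, hP, rfl⟩, (hp hP).2.trans h1⟩
    · have : Part A (v \ {f} ∪ {g | ∃ E ∈ Pt, g = (PartialBij.comp f k).restrict E})
          = Part A v := by
        ext g
        constructor
        · rintro ⟨⟨hg, hgf⟩ | ⟨P, hP, rfl⟩, hA⟩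
          · exact ⟨hg, hA⟩
          · exfalso
            obtain ⟨z, hz⟩ := (hp hP).1
            have : z ∈ f.imgSet ∩ A := ⟨(hp hP).2 hz, hA hz⟩
            rw [h1] at this
            exact this
        · rintro ⟨hg, hA⟩
          refine ⟨Or.inl ⟨hg, ?_⟩, hA⟩
          rintro rfl
          obtain ⟨z, hz⟩ := (hv _ hf).1
          have : z ∈ g.imgSet ∩ A := ⟨hz, hA hz⟩
          rw [h1] at this
          exact this
      rw [this]

theorem steps {X : Type*} {S : Set (PartialBij X)} (SS : SStructure S) (A : Set X)
    {v w : Set (PartialBij X)} (hv : Adapted A v)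
    (h : Relation.ReflTransGen (Expansion SS) v w) :
    Adapted A w ∧ Relation.ReflTransGen (Expansion SS) (Part A v) (Part A w) := by
  induction h with
  | refl => exact ⟨hv, .refl⟩
  | tail _ h ih =>
    have := step SS A ih.1 h
    exact ⟨this.1, ih.2.trans this.2⟩

theorem pvle_part {X : Type*} {S : Set (PartialBij X)} (SS : SStructure S) (A : Set X)
    {v w : Set (PartialBij X)} (hv : Adapted A v) (h : PVLE SS v w) :
    PVLE SS (Part A v) (Part A w) := by
  obtain ⟨w', h1, h2, h3⟩ := h
  refine ⟨Part A w', (steps SS A hv h1).2, ?_, ?_⟩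
  · rintro f ⟨hf, hA⟩
    obtain ⟨g, hg, hr⟩ := h2 f hf
    exact ⟨g, ⟨hg, pairRel_img SS hr ▸ hA⟩, hr⟩
  · rintro g ⟨hg, hA⟩
    obtain ⟨f, hf, hr⟩ := h3 g hg
    exact ⟨f, ⟨hf, (pairRel_img SS hr).symm ▸ hA⟩, hr⟩

theorem sub_of_pvle {X : Type*} {S : Set (PartialBij X)} (SS : SStructure S)
    {f : PartialBij X} (hf : f.imgSet.Nonempty) {w : Set (PartialBij X)}
    (h : PVLE SS {f} w) : ∀ g ∈ w, g.imgSet ⊆ f.imgSet := by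
  obtain ⟨w', h1, h2, h3⟩ := h
  have key : ∀ g ∈ w', g.imgSet.Nonempty ∧ g.imgSet ⊆ f.imgSet := by
    clear h2 h3
    induction h1 with
    | refl =>
      rintro g rfl
      exact ⟨hf, subset_rfl⟩
    | tail _ h ih =>
      obtain ⟨f', hf', Dh, k, Pt, hk, hPt, hne, rfl⟩ := h
      rintro g (⟨hg, _⟩ | ⟨P, hP, rfl⟩)
      · exact ih g hg
      · have := piece_img SS (ih f' hf').1 hk hPt hP
        exact ⟨this.1, this.2.trans (ih f' hf').2⟩
  intro g hg
  obtain ⟨f', hf', hr⟩ := h3 g hg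
  rw [← pairRel_img SS hr]
  exact (key f' hf').2

theorem img_nonempty {X : Type*} {S : Set (PartialBij X)} {f : PartialBij X}
    (h : IsSPair S f) : f.imgSet.Nonempty := by
  obtain ⟨_, ⟨x, y, h⟩, _⟩ := h
  exact ⟨y, x, h⟩

theorem part_eq {X : Type*} {S : Set (PartialBij X)} (SS : SStructure S)
    (E : PartialBij X → Set (Set (PartialBij X)))
    (hE : IsExpansionScheme SS E) {v : Set (PartialBij X)} (hv : IsPseudovertex S v)
    (F : PartialBij X → Set (PartialBij X)) (hF : ∀ f ∈ v, F f ∈ E f)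
    {f : PartialBij X} (hf : f ∈ v) :
    Adapted f.imgSet (⋃ f ∈ v, F f) ∧ Part f.imgSet (⋃ f ∈ v, F f) = F f := by
  have hsub : ∀ f ∈ v, ∀ g ∈ F f, g.imgSet.Nonempty ∧ g.imgSet ⊆ f.imgSet := by
    intro f hf g hg
    have h1 := (hE f (hv.2.2.1 f hf)).1 _ (hF f hf)
    exact ⟨img_nonempty (h1.1.2.2.1 g hg),
      sub_of_pvle SS (img_nonempty (hv.2.2.1 f hf)) h1.2 g hg⟩
  constructor
  · intro g hg
    simp only [Set.mem_iUnion] at hg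
    obtain ⟨f', hf', hg⟩ := hg
    have h := hsub f' hf' g hg
    refine ⟨h.1, ?_⟩
    by_cases e : f' = f
    · subst e
      exact Or.inl h.2
    · right
      exact Set.subset_eq_empty (Set.inter_subset_inter_left _ h.2)
        (hv.2.2.2 f' hf' f hf e)
  · ext g
    constructor
    · rintro ⟨hg, hA⟩
      simp only [Set.mem_iUnion] at hg
      obtain ⟨f', hf', hg⟩ := hg
      have h := hsub f' hf' g hg
      by_cases e : f' = f
      · subst e
        exact hg
      · exfalso
        obtain ⟨z, hz⟩ := h.1
        have : z ∈ f'.imgSet ∩ f.imgSet := ⟨h.2 hz, hA hz⟩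
        rw [hv.2.2.2 f' hf' f hf e] at this
        exact this
    · intro hg
      exact ⟨Set.mem_biUnion hf hg, (hsub f hf g hg).2⟩

theorem eexp_step {X : Type*} {S : Set (PartialBij X)} (SS : SStructure S)
    (E : PartialBij X → Set (Set (PartialBij X)))
    (hE : IsExpansionScheme SS E) {v w₁ w₂ : Set (PartialBij X)} (hv : IsPseudovertex S v)
    (h1 : EExpansionFrom E v w₁) (h2 : EExpansionFrom E v w₂) (hle : PVLE SS w₁ w₂) :
    EExpansionFrom E w₁ w₂ := by
  classical
  obtain ⟨F, hF, rfl⟩ := h1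
  obtain ⟨G, hG, rfl⟩ := h2
  have key : ∀ f ∈ v, EExpansionFrom E (F f) (G f) := by
    intro f hf
    have a := part_eq SS E hE hv F hF hf
    have b := part_eq SS E hE hv G hG hf
    have := pvle_part SS f.imgSet a.1 hle
    rw [a.2, b.2] at this
    exact (hE f (hv.2.2.1 f hf)).2.2.2 _ (hF f hf) _ (hG f hf) this
  choose! H hH hHe using key
  have huniq : ∀ f ∈ v, ∀ f' ∈ v, ∀ g, g ∈ F f → g ∈ F f' → f = f' := by
    intro f hf f' hf' g hg hg'
    by_contra e
    have a := part_eq SS E hE hv F hF hf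
    have b := part_eq SS E hE hv F hF hf'
    obtain ⟨z, hz⟩ := (a.1 g (Set.mem_biUnion hf hg)).1
    rw [← a.2] at hg
    rw [← b.2] at hg'
    have : z ∈ f.imgSet ∩ f'.imgSet := ⟨hg.2 hz, hg'.2 hz⟩
    rw [hv.2.2.2 f hf f' hf' e] at this
    exact this
  have hex : ∀ g, ∃ f, g ∈ (⋃ f ∈ v, F f) → f ∈ v ∧ g ∈ F f := by
    intro g
    by_cases hg : g ∈ (⋃ f ∈ v, F f)
    · have hg' := hg
      simp only [Set.mem_iUnion] at hg'
      obtain ⟨f, hf, hg'⟩ := hg'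
      exact ⟨f, fun _ => ⟨hf, hg'⟩⟩
    · exact ⟨g, fun h => absurd h hg⟩
  choose φ hφ using hex
  refine ⟨fun g => H (φ g) g, fun g hg => hH _ (hφ g hg).1 g (hφ g hg).2, ?_⟩
  ext k
  constructor
  · intro hk
    simp only [Set.mem_iUnion] at hk
    obtain ⟨f, hf, hk⟩ := hk
    rw [hHe f hf] at hk
    simp only [Set.mem_iUnion] at hk
    obtain ⟨g, hg, hk⟩ := hk
    have hgU : g ∈ (⋃ f ∈ v, F f) := Set.mem_biUnion hf hg
    have e : φ g = f := huniq _ (hφ g hgU).1 _ hf g (hφ g hgU).2 hg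
    refine Set.mem_biUnion hgU ?_
    rw [e]
    exact hk
  · intro hk
    rw [Set.mem_iUnion₂] at hk
    obtain ⟨g, hg, hk⟩ := hk
    have h := hφ g hg
    refine Set.mem_biUnion h.1 ?_
    rw [hHe _ h.1]
    exact Set.mem_biUnion h.2 hk

/-- if `v₁ < v₂ < ⋯ < vₘ` is an `ℰ`-chain with `m ≥ 2`, then the
sequence obtained by omitting any one `v_i` is again an `ℰ`-chain. -/
theorem statement19 {X : Type*} (S : Set (PartialBij X))
    (hcomp : ∀ f ∈ S, ∀ g ∈ S, PartialBij.comp g f ∈ S)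
    (hinv : ∀ f ∈ S, PartialBij.inv f ∈ S)
    (SS : SStructure S)
    (E : PartialBij X → Set (Set (PartialBij X)))
    (hE : IsExpansionScheme SS E)
    (n : ℕ) (c : Fin (n + 2) → Set (PartialBij X))
    (hc : IsEChain SS E (n + 1) c) (i : Fin (n + 2)) :
    IsEChain SS E n (fun j => c (i.succAbove j)) := by
  obtain ⟨h1, h2, h3⟩ := hc
  refine ⟨fun j => h1 _, fun a b hab => h2 _ _ (i.strictMono_succAbove hab), fun j => ?_⟩
  by_cases hj : j = 0
  · subst hj
    refine ⟨fun f => {f}, fun f hf => (hE f ((h1 _).2.2.1 f hf)).2.1, ?_⟩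
    simp
  · exact eexp_step SS E hE (h1 0) (h3 _) (h3 _)
      (h2 _ _ (i.strictMono_succAbove (Fin.pos_iff_ne_zero.mpr hj))).1

end GTLD
end
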